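/- arXiv:2409.16064 — 2 statements merged into one kernel-verified Lean document; each statement's English description precedes it below -/
import Mathlib

section
/- Let T¹, …, T^k be the tail σ-algebras of k independent continuous-time Markov chains X¹, …, X^k on a countable state space, each with trivial tail σ-algebra. Then the joint tail σ-algebra G = ∩_{t≥0} σ(X¹_s, …, X^k_s : s ≥ t) is trivial, i.e., every event in G has probability 0 or 1. -/
open MeasureTheory ProbabilityTheory

noncomputable section

section TrivialTail

variable {Ω : Type*}

/-- Intersections of a set of `m₁` with a set of `m₂` form a generating family of `m₁ ⊔ m₂`. -/
theorem sup_eq_generateFrom_image2_inter (m₁ m₂ : MeasurableSpace Ω) :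
    m₁ ⊔ m₂ = MeasurableSpace.generateFrom
      (Set.image2 (· ∩ ·) {s | MeasurableSet[m₁] s} {s | MeasurableSet[m₂] s}) := by
  apply le_antisymm
  · refine sup_le (fun s hs => ?_) (fun s hs => ?_)
    · exact MeasurableSpace.measurableSet_generateFrom
        ⟨s, hs, Set.univ, @MeasurableSet.univ _ m₂, Set.inter_univ s⟩
    · exact MeasurableSpace.measurableSet_generateFrom
        ⟨Set.univ, @MeasurableSet.univ _ m₁, s, hs, Set.univ_inter s⟩
  · refine MeasurableSpace.generateFrom_le ?_
    rintro _ ⟨s, hs, t, ht, rfl⟩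
    exact @MeasurableSet.inter _ (m₁ ⊔ m₂) _ _ ((le_sup_left : m₁ ≤ m₁ ⊔ m₂) s hs)
      ((le_sup_right : m₂ ≤ m₁ ⊔ m₂) t ht)

theorem isPiSystem_image2_inter (m₁ m₂ : MeasurableSpace Ω) :
    IsPiSystem (Set.image2 (· ∩ ·) {s | MeasurableSet[m₁] s} {s | MeasurableSet[m₂] s}) := by
  rintro _ ⟨s, hs, t, ht, rfl⟩ _ ⟨s', hs', t', ht', rfl⟩ -
  exact ⟨s ∩ s', @MeasurableSet.inter _ m₁ _ _ hs hs', t ∩ t',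
    @MeasurableSet.inter _ m₂ _ _ ht ht', Set.inter_inter_inter_comm s s' t t'⟩

variable {F M H T : MeasurableSpace Ω} [mΩ : MeasurableSpace Ω] {P : Measure Ω}
  {B D : Set Ω}

theorem integrable_indicator_one [IsFiniteMeasure P] (hB : MeasurableSet B) :
    Integrable (B.indicator fun _ => (1 : ℝ)) P :=
  (integrable_const 1).indicator hB

theorem setIntegral_condExp_indicator_eq_integral_mul [IsFiniteMeasure P]
    (hF : F ≤ mΩ) (B : Set Ω)
    (hD : MeasurableSet D) :
    ∫ ω in D, (P⟦B | F⟧) ω ∂P = ∫ ω, (P⟦B | F⟧) ω * (P⟦D | F⟧) ω ∂P := by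
  have hmul : P⟦B | F⟧ * D.indicator (fun _ => (1 : ℝ)) = D.indicator (P⟦B | F⟧) := by
    ext ω
    by_cases h : ω ∈ D <;> simp [h]
  have hpull := condExp_mul_of_stronglyMeasurable_left (μ := P) (m := F)
    (f := P⟦B | F⟧) (g := D.indicator fun _ => (1 : ℝ)) stronglyMeasurable_condExp
    (by rw [hmul]; exact integrable_condExp.indicator hD) (integrable_indicator_one hD)
  rw [← integral_indicator hD, ← hmul, ← integral_condExp hF]
  exact integral_congr_ae hpull

/-- Conditional expectation is symmetric, stated for indicators. -/
theorem setIntegral_condExp_indicator_comm [IsFiniteMeasure P] (hF : F ≤ mΩ)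
    (hB : MeasurableSet B) (hD : MeasurableSet D) :
    ∫ ω in D, (P⟦B | F⟧) ω ∂P = ∫ ω in B, (P⟦D | F⟧) ω ∂P := by
  rw [setIntegral_condExp_indicator_eq_integral_mul hF B hD,
    setIntegral_condExp_indicator_eq_integral_mul hF D hB]
  simp_rw [mul_comm]

theorem setIntegral_inter_of_indep (hM : M ≤ mΩ) (hH : H ≤ mΩ) (hMH : Indep M H P)
    {f : Ω → ℝ} (hf : StronglyMeasurable[M] f) {s t : Set Ω}
    (hs : MeasurableSet[M] s) (ht : MeasurableSet[H] t) :
    ∫ ω in s ∩ t, f ω ∂P = (∫ ω in s, f ω ∂P) * P.real t := by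
  have hsf : StronglyMeasurable[M] (s.indicator f) := hf.indicator hs
  have htm : StronglyMeasurable[H] (t.indicator fun _ => (1 : ℝ)) :=
    stronglyMeasurable_const.indicator ht
  have hind : IndepFun (s.indicator f) (t.indicator fun _ => (1 : ℝ)) P :=
    (IndepFun_iff_Indep _ _ _).2
      (indep_of_indep_of_le_left (indep_of_indep_of_le_right hMH htm.measurable.comap_le)
        hsf.measurable.comap_le)
  have hmul : (s ∩ t).indicator f = s.indicator f * t.indicator (fun _ => (1 : ℝ)) := by
    ext ω
    by_cases h : ω ∈ s <;> by_cases h' : ω ∈ t <;> simp [h, h']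
  rw [← integral_indicator ((hM s hs).inter (hH t ht)), hmul,
    hind.integral_mul_eq_mul_integral (hsf.mono hM).aestronglyMeasurable
      (htm.mono hH).aestronglyMeasurable, integral_indicator (hM s hs),
    integral_indicator (hH t ht)]
  simp

/-- If `H` is independent of `M ⊇ F`, then conditioning `B ∈ M` on `F ⊔ H` is the same as
conditioning it on `F`. -/
theorem setIntegral_condExp_indicator_of_indep [IsFiniteMeasure P]
    (hFM : F ≤ M) (hM : M ≤ mΩ) (hH : H ≤ mΩ) (hMH : Indep M H P)
    (hB : MeasurableSet[M] B) (hD : MeasurableSet[F ⊔ H] D) :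
    ∫ ω in D, (P⟦B | F⟧) ω ∂P = P.real (B ∩ D) := by
  have hF : F ≤ mΩ := hFM.trans hM
  have hle : F ⊔ H ≤ mΩ := sup_le hF hH
  have hBΩ : MeasurableSet B := hM B hB
  have hset : ∀ s, MeasurableSet[F] s → ∫ ω in s, (P⟦B | F⟧) ω ∂P = P.real (B ∩ s) := by
    intro s hs
    rw [setIntegral_condExp hF (integrable_indicator_one hBΩ) hs, setIntegral_indicator hBΩ,
      Set.inter_comm]
    simp
  induction D, hD using MeasurableSpace.induction_on_inter
    (sup_eq_generateFrom_image2_inter F H) (isPiSystem_image2_inter F H) with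
  | empty => simp
  | basic D hD =>
    obtain ⟨s, hs, t, ht, rfl⟩ := hD
    have hprod := (Indep_iff _ _ _).1 hMH (B ∩ s) t (hB.inter (hFM s hs)) ht
    rw [setIntegral_inter_of_indep hM hH hMH (stronglyMeasurable_condExp.mono hFM)
      (hFM s hs) ht, hset s hs, ← Set.inter_assoc]
    simp [measureReal_def, hprod]
  | compl D hD ih =>
    have hadd := integral_add_compl (hle D hD) (integrable_condExp (μ := P) (m := F)
      (f := B.indicator fun _ => (1 : ℝ)))
    have huniv := hset Set.univ (@MeasurableSet.univ _ F)
    rw [setIntegral_univ, Set.inter_univ] at huniv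
    have hdiff := measureReal_inter_add_sdiff (μ := P) (s := B) (hle D hD)
    rw [Set.sdiff_eq] at hdiff
    linarith
  | iUnion D hdisj hD ih =>
    rw [integral_iUnion (fun i => hle _ (hD i)) hdisj integrable_condExp.integrableOn,
      Set.inter_iUnion, measureReal_def, measure_iUnion
        (fun i j hij => (hdisj hij).mono Set.inter_subset_right Set.inter_subset_right)
        (fun i => hBΩ.inter (hle _ (hD i))), ENNReal.tsum_toReal_eq (fun _ => measure_ne_top _ _)]
    exact tsum_congr ih

theorem condExp_indicator_ae_eq_of_indep [IsFiniteMeasure P]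
    (hFM : F ≤ M) (hM : M ≤ mΩ) (hH : H ≤ mΩ)
    (hMH : Indep M H P) (hD : MeasurableSet[F ⊔ H] D) :
    P⟦D | F⟧ =ᵐ[P] P⟦D | M⟧ := by
  have hF : F ≤ mΩ := hFM.trans hM
  have hDΩ : MeasurableSet D := sup_le hF hH D hD
  refine ae_eq_condExp_of_forall_setIntegral_eq hM (integrable_indicator_one hDΩ)
    (fun _ _ _ => integrable_condExp.integrableOn) (fun B hB _ => ?_)
    (stronglyMeasurable_condExp.mono hFM).aestronglyMeasurable
  rw [← setIntegral_condExp_indicator_comm hF (hM B hB) hDΩ,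
    setIntegral_condExp_indicator_of_indep hFM hM hH hMH hB hD, setIntegral_indicator hDΩ]
  simp

/-- A function that is a.e. measurable for each member of a decreasing sequence of σ-algebras is
a.e. measurable for their intersection. -/
theorem exists_measurable_iInf_ae_eq {F : ℕ → MeasurableSpace Ω} (hF : Antitone F)
    {f : Ω → ℝ} {g : ℕ → Ω → ℝ} (hg : ∀ n, Measurable[F n] (g n)) (hfg : ∀ n, g n =ᵐ[P] f) :
    ∃ h : Ω → ℝ, Measurable[⨅ n, F n] h ∧ h =ᵐ[P] f := by
  refine ⟨fun ω => Filter.limsup (fun n => g n ω) Filter.atTop, fun s hs => ?_, ?_⟩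
  · rw [MeasurableSpace.measurableSet_iInf]
    intro N
    have hN : Measurable[F N] fun ω => Filter.limsup (fun n => g (n + N) ω) Filter.atTop :=
      @Measurable.limsup _ _ _ _ _ (F N) _ _ _ _
        fun n => (hg (n + N)).mono (hF (Nat.le_add_left N n)) le_rfl
    have heq : ∀ ω, Filter.limsup (fun n => g (n + N) ω) Filter.atTop =
        Filter.limsup (fun n => g n ω) Filter.atTop :=
      fun ω => Filter.limsup_nat_add (fun n => g n ω) N
    simp_rw [heq] at hN
    exact hN hs
  · filter_upwards [ae_all_iff.2 hfg] with ω hω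
    simp [hω]

theorem indep_of_forall_measure_eq_zero_or_one [IsProbabilityMeasure P]
    (hT : ∀ A, MeasurableSet[T] A → P A = 0 ∨ P A = 1) (hTΩ : T ≤ mΩ) :
    Indep mΩ T P := by
  refine (Indep_iff _ _ _).2 fun B A _ hA => ?_
  rcases hT A hA with h | h
  · rw [measure_inter_null_of_null_right B h, h, mul_zero]
  · have hc : P Aᶜ = 0 := (prob_compl_eq_zero_iff (hTΩ A hA)).2 h
    rw [Set.inter_comm, Measure.measure_inter_eq_of_ae (mem_ae_iff.2 hc), h, mul_one]

/-- If `F n` decreases to a trivial σ-algebra inside `M` and `H` is independent of `M`, then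
`⨅ n, F n ⊔ H` is independent of `M`. -/
theorem indep_iInf_sup [IsProbabilityMeasure P] {F : ℕ → MeasurableSpace Ω} (hF : Antitone F)
    (hFM : ∀ n, F n ≤ M)
    (hM : M ≤ mΩ) (hH : H ≤ mΩ) (hMH : Indep M H P)
    (htriv : ∀ A, MeasurableSet[⨅ n, F n] A → P A = 0 ∨ P A = 1) :
    Indep M (⨅ n, F n ⊔ H) P := by
  have hTM : ⨅ n, F n ≤ M := (iInf_le F 0).trans (hFM 0)
  have hT : ⨅ n, F n ≤ mΩ := hTM.trans hM
  refine (Indep_iff _ _ _).2 fun B D hB hD => ?_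
  rw [MeasurableSpace.measurableSet_iInf] at hD
  have hDΩ : MeasurableSet D := sup_le ((hFM 0).trans hM) hH D (hD 0)
  have hBΩ : MeasurableSet B := hM B hB
  obtain ⟨h, hh, hhD⟩ := exists_measurable_iInf_ae_eq (P := P) hF
    (fun n => (stronglyMeasurable_condExp (μ := P) (m := F n)
      (f := D.indicator fun _ => (1 : ℝ))).measurable)
    (fun n => condExp_indicator_ae_eq_of_indep (hFM n) hM hH hMH (hD n))
  have hconst : P⟦D | M⟧ =ᵐ[P] fun _ => P.real D := by
    have h₁ : P[h | ⨅ n, F n] = h :=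
      condExp_of_stronglyMeasurable hT hh.stronglyMeasurable
        (integrable_condExp.congr hhD.symm)
    have h₂ : P⟦D | ⨅ n, F n⟧ =ᵐ[P] fun _ => ∫ ω, D.indicator (fun _ => (1 : ℝ)) ω ∂P :=
      condExp_indep_eq le_rfl hT (stronglyMeasurable_const.indicator hDΩ)
        (indep_of_forall_measure_eq_zero_or_one htriv hT)
    have h₃ : P[P⟦D | M⟧ | ⨅ n, F n] =ᵐ[P] P⟦D | ⨅ n, F n⟧ := condExp_condExp_of_le hTM hM
    have h₄ : P[h | ⨅ n, F n] =ᵐ[P] P[P⟦D | M⟧ | ⨅ n, F n] := condExp_congr_ae hhD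
    rw [h₁] at h₄
    filter_upwards [hhD, h₂, h₃, h₄] with ω e e₂ e₃ e₄
    rw [← e, e₄, e₃, e₂, integral_indicator hDΩ]
    simp
  have hreal : P.real (B ∩ D) = P.real B * P.real D := by
    calc P.real (B ∩ D) = ∫ ω in B, D.indicator (fun _ => (1 : ℝ)) ω ∂P := by
          rw [setIntegral_indicator hDΩ]; simp
      _ = ∫ ω in B, (P⟦D | M⟧) ω ∂P :=
          (setIntegral_condExp hM (integrable_indicator_one hDΩ) hB).symm
      _ = ∫ _ in B, P.real D ∂P := integral_congr_ae (ae_restrict_of_ae hconst)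
      _ = P.real B * P.real D := by simp
  rwa [measureReal_def, measureReal_def, measureReal_def, ← ENNReal.toReal_mul,
    ENNReal.toReal_eq_toReal_iff' (measure_ne_top _ _)
      (ENNReal.mul_ne_top (measure_ne_top _ _) (measure_ne_top _ _))] at hreal

/-- **Zero-one law for the joint tail** of independent decreasing sequences of
σ-algebras with trivial tails. -/
theorem measure_zero_or_one_of_measurableSet_iInf_iSup [IsProbabilityMeasure P] {ι : Type*}
    {F : ι → ℕ → MeasurableSpace Ω} {M : ι → MeasurableSpace Ω} (hF : ∀ i, Antitone (F i))
    (hFM : ∀ i n, F i n ≤ M i) (hM : ∀ i, M i ≤ mΩ) (hindep : iIndep M P)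
    (htriv : ∀ i A, MeasurableSet[⨅ n, F i n] A → P A = 0 ∨ P A = 1)
    {A : Set Ω} (hA : ∀ n, MeasurableSet[⨆ i, F i n] A) :
    P A = 0 ∨ P A = 1 := by
  have hAM : MeasurableSet[⨆ i, M i] A := iSup_mono (fun i => hFM i 0) A (hA 0)
  have hAΩ : MeasurableSet A := iSup_le hM A hAM
  have hsup : ∀ i n, ⨆ j, F j n ≤ F i n ⊔ ⨆ j ∈ ({i}ᶜ : Set ι), M j := by
    intro i n
    refine iSup_le fun j => ?_
    by_cases hj : j = i
    · exact hj ▸ le_sup_left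
    · exact (hFM j n).trans (le_sup_of_le_right (le_biSup M hj))
  have hstep : ∀ i, Indep (M i) (⨅ n, F i n ⊔ ⨆ j ∈ ({i}ᶜ : Set ι), M j) P := by
    intro i
    refine indep_iInf_sup (hF i) (hFM i) (hM i) (iSup₂_le fun j _ => hM j) ?_ (htriv i)
    simpa using indep_iSup_of_disjoint hM hindep
      (S := {i}) (T := {i}ᶜ) disjoint_compl_right
  have hprod : ∀ (s : Finset ι) (B : ι → Set Ω), (∀ i ∈ s, MeasurableSet[M i] (B i)) →
      P (A ∩ ⋂ i ∈ s, B i) = P A * ∏ i ∈ s, P (B i) := by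
    classical
    intro s B
    induction s using Finset.induction_on with
    | empty => simp
    | insert i s his ih =>
      intro hB
      have hD : MeasurableSet[⨅ n, F i n ⊔ ⨆ j ∈ ({i}ᶜ : Set ι), M j]
          (A ∩ ⋂ j ∈ s, B j) := by
        rw [MeasurableSpace.measurableSet_iInf]
        refine fun n => (hsup i n A (hA n)).inter (s.measurableSet_biInter fun j hj => ?_)
        have hji : j ∈ ({i}ᶜ : Set ι) := fun h => his (h ▸ hj)
        exact (le_sup_of_le_right (le_biSup M hji)) _ (hB j (Finset.mem_insert_of_mem hj))
      rw [Finset.set_biInter_insert, Set.inter_left_comm,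
        (Indep_iff _ _ _).1 (hstep i) _ _ (hB i (Finset.mem_insert_self i s)) hD,
        ih fun j hj => hB j (Finset.mem_insert_of_mem hj), Finset.prod_insert his]
      ring
  have hIndep : Indep (MeasurableSpace.generateFrom {A}) (⨆ i, M i) P := by
    refine IndepSets.indep (MeasurableSpace.generateFrom_le (by simpa using hAΩ))
      (iSup_le hM) (IsPiSystem.singleton A)
      (isPiSystem_piiUnionInter (fun i => {s | MeasurableSet[M i] s})
        (fun i => @MeasurableSpace.isPiSystem_measurableSet _ (M i)) Set.univ) rfl
      (by simpa using (generateFrom_piiUnionInter_measurableSet M Set.univ).symm) ?_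
    rw [IndepSets_iff]
    rintro _ _ rfl ⟨s, -, B, hB, rfl⟩
    rw [hprod s B hB, hindep.meas_biInter hB]
  refine measure_eq_zero_or_one_of_indepSet_self ?_
  exact (indepSet_iff_measure_inter_eq_mul hAΩ hAΩ P).2 ((Indep_iff _ _ _).1 hIndep A A
    (MeasurableSpace.measurableSet_generateFrom rfl) hAM)

end TrivialTail

/-- if `X¹, …, X^k` are independent continuous-time processes on a
countable state space, each with trivial tail σ-algebra, then the joint tail
σ-algebra `⋂_{t} σ(X¹_s, …, X^k_s : s ≥ t)` is trivial. -/
theorem stmt6 {Ω S : Type*} [MeasurableSpace Ω] [Countable S]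
    (P : Measure Ω) [IsProbabilityMeasure P]
    (k : ℕ) (X : Fin k → ℝ → Ω → S)
    (hmeas : ∀ i t, @Measurable Ω S _ ⊤ (X i t))
    -- the processes are independent
    (hindep : iIndep (fun i : Fin k => ⨆ t : ℝ, MeasurableSpace.comap (X i t) ⊤) P)
    -- each individual tail σ-algebra is trivial
    (htail : ∀ i : Fin k, ∀ A : Set Ω,
      MeasurableSet[⨅ t : ℝ, ⨆ s ∈ Set.Ici t, MeasurableSpace.comap (X i s) ⊤] A →
        P A = 0 ∨ P A = 1) :
    -- then the joint tail σ-algebra is trivial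
    ∀ A : Set Ω,
      MeasurableSet[⨅ t : ℝ, ⨆ s ∈ Set.Ici t, ⨆ i : Fin k,
        MeasurableSpace.comap (X i s) ⊤] A →
      P A = 0 ∨ P A = 1 := by
  intro A hA
  let F : Fin k → ℕ → MeasurableSpace Ω :=
    fun i n => ⨆ s ∈ Set.Ici (n : ℝ), MeasurableSpace.comap (X i s) ⊤
  refine measure_zero_or_one_of_measurableSet_iInf_iSup (F := F) ?_ ?_ ?_ hindep ?_ ?_
  · intro i m n hmn
    exact biSup_mono fun s hs => Set.Ici_subset_Ici.2 (Nat.cast_le.2 hmn) hs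
  · exact fun i n => iSup₂_le fun s _ => le_iSup (fun t => MeasurableSpace.comap (X i t) ⊤) s
  · exact fun i => iSup_le fun t => (hmeas i t).comap_le
  · intro i A hA
    refine htail i A ((le_iInf fun t => ?_ : ⨅ n, F i n ≤ _) A hA)
    obtain ⟨n, hn⟩ := exists_nat_ge t
    exact (iInf_le _ n).trans (biSup_mono fun s hs => Set.Ici_subset_Ici.2 hn hs)
  · intro n
    refine (iInf_le_of_le (n : ℝ) (iSup₂_le fun s hs => iSup_mono fun i => ?_) :
      _ ≤ ⨆ i, F i n) A hA
    exact le_biSup (fun s => MeasurableSpace.comap (X i s) ⊤) hs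
end
end

section
/- Let ν be an exchangeable probability measure on {0,1}^V for a countably infinite set V, i.e., ν(η : η ≡ 1 on A) depends only on |A| for finite A ⊆ V. Then there exists a unique Borel probability measure γ on [0,1] such that ν = ∫₀¹ π_α γ(dα), where π_α is the Bernoulli(α) product measure on {0,1}^V. -/
open MeasureTheory

noncomputable section

/-- The integral against a probability measure is continuous in the uniform norm. -/
theorem continuous_integral_continuousMap {X : Type*} [TopologicalSpace X] [CompactSpace X]
    [MeasurableSpace X] [BorelSpace X] (μ : Measure X) [IsProbabilityMeasure μ] :
    Continuous fun f : C(X, ℝ) => ∫ x, f x ∂μ := by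
  have hint : ∀ f : C(X, ℝ), Integrable f μ := fun f =>
    (BoundedContinuousFunction.mkOfCompact f).integrable μ
  refine (LipschitzWith.of_dist_le_mul (K := 1) fun f g => ?_).continuous
  rw [Real.dist_eq, ← integral_sub (hint f) (hint g), dist_eq_norm]
  have := norm_integral_le_of_norm_le_const (μ := μ) (f := fun x => f x - g x) (C := ‖f - g‖)
    (.of_forall fun x => (f - g).norm_coe_le_norm x)
  simpa using this

open unitInterval in
/-- A probability measure on the unit interval is determined by its moments. -/
theorem unitInterval_measure_ext_of_moments (μ μ' : Measure I) [IsProbabilityMeasure μ]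
    [IsProbabilityMeasure μ'] (h : ∀ k : ℕ, ∫ x : I, (x : ℝ) ^ k ∂μ = ∫ x : I, (x : ℝ) ^ k ∂μ') :
    μ = μ' := by
  have hint : ∀ (ρ : Measure I) [IsProbabilityMeasure ρ] (f : C(I, ℝ)), Integrable f ρ :=
    fun ρ _ f => (BoundedContinuousFunction.mkOfCompact f).integrable ρ
  have key : ∀ f : C(I, ℝ), ∫ x, f x ∂μ = ∫ x, f x ∂μ' := by
    have hcl : IsClosed {f : C(I, ℝ) | ∫ x, f x ∂μ = ∫ x, f x ∂μ'} :=
      isClosed_eq (continuous_integral_continuousMap μ) (continuous_integral_continuousMap μ')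
    have hpoly : (polynomialFunctions I : Set C(I, ℝ)) ⊆
        {f : C(I, ℝ) | ∫ x, f x ∂μ = ∫ x, f x ∂μ'} := by
      rintro _ ⟨p, -, rfl⟩
      induction p using Polynomial.induction_on' with
      | add p q hp hq =>
        simp only [Set.mem_ofPred_eq, map_add, ContinuousMap.add_apply] at hp hq ⊢
        rw [integral_add (hint μ _) (hint μ _), integral_add (hint μ' _) (hint μ' _)]
        exact congrArg₂ _ hp hq
      | monomial n a =>
        simp [integral_const_mul, h]
    intro f
    have hf : f ∈ (polynomialFunctions I).topologicalClosure := by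
      rw [polynomialFunctions_closure_eq_top']; trivial
    exact hcl.closure_subset_iff.mpr hpoly hf
  exact ext_of_forall_integral_eq_of_IsFiniteMeasure fun f => key f.toContinuousMap

/-- Falling factorials of `y ≤ n` are close to powers, after normalisation by powers of `n`. -/
theorem abs_descFactorial_div_sub_pow_le (k : ℕ) {n y : ℕ} (hn : 0 < n) (hy : y ≤ n) :
    |(y.descFactorial k : ℝ) / (n : ℝ) ^ k - ((y : ℝ) / n) ^ k| ≤ (k : ℝ) ^ 2 / n := by
  have hn' : (0 : ℝ) < n := by exact_mod_cast hn
  have hy' : (y : ℝ) / n ≤ 1 := by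
    rw [div_le_one hn']; exact_mod_cast hy
  have hy0 : 0 ≤ (y : ℝ) / n := by positivity
  induction k with
  | zero => simp
  | succ k ih =>
    have hsub : ((y - k : ℕ) : ℝ) ≤ y := by exact_mod_cast Nat.sub_le y k
    have hsub' : (y : ℝ) ≤ ((y - k : ℕ) : ℝ) + k := by
      exact_mod_cast (by omega : y ≤ y - k + k)
    set a : ℝ := ((y - k : ℕ) : ℝ) / n with ha
    have ha0 : 0 ≤ a := by positivity
    have hay : a ≤ (y : ℝ) / n := by rw [ha]; gcongr
    have hya : (y : ℝ) / n - a ≤ k / n := by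
      rw [ha, ← sub_div]; gcongr; linarith
    have hp1 : ((y : ℝ) / n) ^ k ≤ 1 := pow_le_one₀ hy0 hy'
    have hp0 : 0 ≤ ((y : ℝ) / n) ^ k := by positivity
    have e : ((y.descFactorial (k + 1) : ℕ) : ℝ) / (n : ℝ) ^ (k + 1) - ((y : ℝ) / n) ^ (k + 1) =
        a * ((y.descFactorial k : ℝ) / (n : ℝ) ^ k - ((y : ℝ) / n) ^ k) -
          ((y : ℝ) / n - a) * ((y : ℝ) / n) ^ k := by
      rw [Nat.descFactorial_succ, Nat.cast_mul, pow_succ' (n : ℝ), mul_div_mul_comm, ← ha]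
      ring
    rw [e]
    calc _ ≤ |a * ((y.descFactorial k : ℝ) / (n : ℝ) ^ k - ((y : ℝ) / n) ^ k)| +
          |((y : ℝ) / n - a) * ((y : ℝ) / n) ^ k| := abs_sub _ _
      _ ≤ (k : ℝ) ^ 2 / n + k / n := by
        rw [abs_mul, abs_mul, abs_of_nonneg ha0, abs_of_nonneg hp0,
          abs_of_nonneg (sub_nonneg.mpr hay)]
        refine add_le_add ?_ ?_
        · exact (mul_le_of_le_one_left (abs_nonneg _) (hay.trans hy')).trans ih
        · exact (mul_le_of_le_one_right (sub_nonneg.mpr hay) hp1).trans hya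
      _ ≤ _ := by
        rw [← add_div]; gcongr; push_cast; nlinarith [(Nat.cast_nonneg k : (0 : ℝ) ≤ k)]

/-- The number of indices `i < n` at which the configuration `η ∘ e` is `true`. -/
def countTrue {V : Type*} (e : ℕ → V) (n : ℕ) (η : V → Bool) : ℕ :=
  ((Finset.range n).filter fun i => η (e i) = true).card

theorem countTrue_le {V : Type*} (e : ℕ → V) (n : ℕ) (η : V → Bool) : countTrue e n η ≤ n :=
  (Finset.card_filter_le _ _).trans (Finset.card_range n).le

theorem measurableSet_forall_eq_true {V : Type*} (A : Finset V) :
    MeasurableSet {η : V → Bool | ∀ x ∈ A, η x = true} := by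
  have : {η : V → Bool | ∀ x ∈ A, η x = true} = ⋂ x ∈ A, (fun η => η x) ⁻¹' {true} := by
    ext; simp
  rw [this]
  exact A.measurableSet_biInter fun x _ => measurable_pi_apply x (measurableSet_singleton _)

theorem measurable_countTrue {V : Type*} (e : ℕ → V) (n : ℕ) : Measurable (countTrue e n) := by
  have : countTrue e n = fun η => ∑ i ∈ Finset.range n, if η (e i) = true then 1 else 0 := by
    exact funext fun η => Finset.card_filter _ _
  rw [this]
  refine Finset.measurable_fun_sum _ fun i _ => ?_
  have h : MeasurableSet {η : V → Bool | η (e i) = true} :=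
    measurableSet_eq_fun (measurable_pi_apply (e i)) measurable_const
  exact Measurable.ite h measurable_const measurable_const

theorem choose_countTrue {V : Type*} (e : ℕ ↪ V) (n k : ℕ) (η : V → Bool) :
    ((countTrue e n η).choose k : ℝ) = ∑ A ∈ (Finset.range n).powersetCard k,
      Set.indicator {η : V → Bool | ∀ x ∈ A.map e, η x = true} 1 η := by
  classical
  rw [countTrue, ← Finset.card_powersetCard]
  simp only [Set.indicator_apply, Pi.one_apply]
  rw [← Finset.sum_filter, Finset.sum_const, nsmul_eq_mul, mul_one]
  congr 2
  ext A
  simp only [Finset.mem_powersetCard, Finset.mem_filter, Finset.subset_iff, Finset.mem_map,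
    Set.mem_ofPred_eq]
  grind

theorem integral_descFactorial_countTrue {V : Type*} (ν : Measure (V → Bool))
    [IsProbabilityMeasure ν] (e : ℕ ↪ V) (m : ℕ → ℝ)
    (hm : ∀ A : Finset V, ν.real {η | ∀ x ∈ A, η x = true} = m A.card) (n k : ℕ) :
    ∫ η, ((countTrue e n η).descFactorial k : ℝ) ∂ν = n.descFactorial k * m k := by
  simp only [Nat.descFactorial_eq_factorial_mul_choose, Nat.cast_mul, choose_countTrue]
  rw [integral_const_mul, integral_finsetSum]
  · simp only [integral_indicator_one (measurableSet_forall_eq_true _), hm, Finset.card_map]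
    rw [Finset.sum_congr rfl fun A hA => by rw [(Finset.mem_powersetCard.mp hA).2]]
    simp [mul_assoc]
  · intro A _
    exact (integrable_const 1).indicator (measurableSet_forall_eq_true _)

open Filter Topology in
/-- The moments of the empirical frequencies converge to the cylinder probabilities. -/
theorem tendsto_integral_frequency_pow {V : Type*} (ν : Measure (V → Bool))
    [IsProbabilityMeasure ν] (e : ℕ ↪ V) (m : ℕ → ℝ)
    (hm : ∀ A : Finset V, ν.real {η | ∀ x ∈ A, η x = true} = m A.card) (k : ℕ) :
    Tendsto (fun n : ℕ => ∫ η, ((countTrue e n η : ℝ) / n) ^ k ∂ν) atTop (𝓝 (m k)) := by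
  have hzero : Tendsto (fun n : ℕ => (k : ℝ) ^ 2 / n) atTop (𝓝 0) :=
    tendsto_const_div_atTop_nhds_zero_nat _
  have hone : Tendsto (fun n : ℕ => (n.descFactorial k : ℝ) / (n : ℝ) ^ k) atTop (𝓝 1) := by
    rw [tendsto_iff_dist_tendsto_zero]
    refine squeeze_zero' (.of_forall fun _ => dist_nonneg) ?_ hzero
    filter_upwards [eventually_gt_atTop 0] with n hn
    have hn' : (n : ℝ) ≠ 0 := by positivity
    simpa [Real.dist_eq, div_self hn'] using abs_descFactorial_div_sub_pow_le k hn le_rfl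
  have hlim : Tendsto (fun n : ℕ => (n.descFactorial k : ℝ) / (n : ℝ) ^ k * m k) atTop
      (𝓝 (m k)) := by
    simpa using hone.mul_const (m k)
  refine tendsto_of_tendsto_of_dist hlim ?_
  refine squeeze_zero' (.of_forall fun _ => dist_nonneg) ?_ hzero
  filter_upwards [eventually_gt_atTop 0] with n hn
  have hbdd : ∀ f : ℕ → ℝ, Integrable (fun η => f (countTrue e n η)) ν := by
    intro f
    refine Integrable.of_bound (C := ∑ i ∈ Finset.range (n + 1), ‖f i‖)
      ((measurable_from_nat (f := f)).comp (measurable_countTrue e n)).aestronglyMeasurable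
      (.of_forall fun η => ?_)
    exact Finset.single_le_sum (f := fun i => ‖f i‖) (fun _ _ => norm_nonneg _)
      (Finset.mem_range.mpr (Nat.lt_succ_of_le (countTrue_le e n η)))
  have hE : (n.descFactorial k : ℝ) / (n : ℝ) ^ k * m k =
      ∫ η, ((countTrue e n η).descFactorial k : ℝ) / (n : ℝ) ^ k ∂ν := by
    rw [integral_div, integral_descFactorial_countTrue ν e m hm]
    ring
  rw [hE, Real.dist_eq, ← integral_sub (hbdd fun y => (y.descFactorial k : ℝ) / (n : ℝ) ^ k)
    (hbdd fun y => ((y : ℝ) / n) ^ k)]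
  have := norm_integral_le_of_norm_le_const (μ := ν) (C := (k : ℝ) ^ 2 / n)
    (f := fun η => ((countTrue e n η).descFactorial k : ℝ) / (n : ℝ) ^ k -
      ((countTrue e n η : ℝ) / n) ^ k)
    (.of_forall fun η => abs_descFactorial_div_sub_pow_le k hn (countTrue_le e n η))
  simpa using this

open Filter Topology unitInterval in
/-- The cylinder probabilities of an exchangeable measure are the moments of a probability
measure on the unit interval. -/
theorem exists_unitInterval_measure_moments {V : Type*} (ν : Measure (V → Bool))
    [IsProbabilityMeasure ν] (e : ℕ ↪ V) (m : ℕ → ℝ)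
    (hm : ∀ A : Finset V, ν.real {η | ∀ x ∈ A, η x = true} = m A.card) :
    ∃ μ : Measure I, IsProbabilityMeasure μ ∧ ∀ k : ℕ, ∫ x : I, (x : ℝ) ^ k ∂μ = m k := by
  let S : ℕ → (V → Bool) → I := fun n η => ⟨(countTrue e n η : ℝ) / n, by positivity,
    div_le_one_of_le₀ (by exact_mod_cast countTrue_le e n η) (by positivity)⟩
  have hS : ∀ n, Measurable (S n) := fun n =>
    ((measurable_from_nat (f := fun y : ℕ => (y : ℝ) / n)).comp
      (measurable_countTrue e n)).subtype_mk
  let μs : ℕ → ProbabilityMeasure I := fun n =>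
    ⟨ν.map (S n), Measure.isProbabilityMeasure_map (hS n).aemeasurable⟩
  obtain ⟨μ, -, hμ⟩ := isCompact_univ.ultrafilter_le_nhds ((hyperfilter ℕ).map μs) (by simp)
  have hμ' : Tendsto μs (hyperfilter ℕ : Filter ℕ) (𝓝 μ) := hμ
  refine ⟨μ, inferInstance, fun k => ?_⟩
  let g : C(I, ℝ) := ⟨fun x => (x : ℝ) ^ k, by fun_prop⟩
  have h1 := ProbabilityMeasure.tendsto_iff_forall_integral_tendsto.mp hμ'
    (BoundedContinuousFunction.mkOfCompact g)
  have h2 := (tendsto_integral_frequency_pow ν e m hm k).mono_left Nat.hyperfilter_le_atTop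
  refine tendsto_nhds_unique h1 (h2.congr fun n => ?_)
  exact (integral_map (hS n).aemeasurable
    g.continuous.aestronglyMeasurable).symm

open unitInterval in
theorem lintegral_ofReal_pow_unitInterval (μ : Measure I) [IsProbabilityMeasure μ] (k : ℕ) :
    ∫⁻ x : I, ENNReal.ofReal ((x : ℝ) ^ k) ∂μ = ENNReal.ofReal (∫ x : I, (x : ℝ) ^ k ∂μ) := by
  let g : C(I, ℝ) := ⟨fun x => (x : ℝ) ^ k, by fun_prop⟩
  exact (ofReal_integral_eq_lintegral_ofReal
    ((BoundedContinuousFunction.mkOfCompact g).integrable μ)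
    (.of_forall fun x => pow_nonneg x.2.1 k)).symm

/-- de Finetti: an exchangeable probability measure `ν` on
`{0,1}^V`, `V` countably infinite — i.e. one whose cylinder probabilities
`ν(η ≡ 1 on A)` depend only on `|A|` — is a unique mixture of Bernoulli product
measures: there is a unique Borel probability measure `γ` on `[0,1]` with
`ν(η ≡ 1 on A) = ∫₀¹ α^{|A|} γ(dα)` for all finite `A` (which is the defining
property of `ν = ∫₀¹ π_α γ(dα)`). -/
theorem stmt12 {V : Type*} [Countable V] [Infinite V]
    (ν : Measure (V → Bool)) [IsProbabilityMeasure ν]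
    (hexch : ∀ A B : Finset V, A.card = B.card →
      ν {η | ∀ x ∈ A, η x = true} = ν {η | ∀ x ∈ B, η x = true}) :
    ∃! γ : Measure ℝ,
      IsProbabilityMeasure γ ∧ γ (Set.Icc (0:ℝ) 1)ᶜ = 0 ∧
      ∀ A : Finset V,
        ν {η | ∀ x ∈ A, η x = true} =
          ∫⁻ α in Set.Icc (0:ℝ) 1, ENNReal.ofReal (α ^ A.card) ∂γ := by
  have E : ℕ ↪ V := Infinite.natEmbedding V
  let m : ℕ → ℝ := fun k => ν.real {η | ∀ x ∈ (Finset.range k).map E, η x = true}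
  have hm : ∀ A : Finset V, ν.real {η | ∀ x ∈ A, η x = true} = m A.card := fun A =>
    congrArg ENNReal.toReal (hexch _ _ (by simp))
  have hm' : ∀ A : Finset V, ν {η | ∀ x ∈ A, η x = true} = ENNReal.ofReal (m A.card) := by
    intro A
    rw [← hm, ofReal_measureReal]
  have hI : MeasurableSet (Set.Icc (0 : ℝ) 1) := measurableSet_Icc
  obtain ⟨μ, hμ, hmom⟩ := exists_unitInterval_measure_moments ν E m hm
  have huniq : ∀ γ : Measure ℝ, IsProbabilityMeasure γ ∧ γ (Set.Icc (0:ℝ) 1)ᶜ = 0 ∧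
      (∀ A : Finset V, ν {η | ∀ x ∈ A, η x = true} =
        ∫⁻ α in Set.Icc (0:ℝ) 1, ENNReal.ofReal (α ^ A.card) ∂γ) → γ = μ.map Subtype.val := by
    rintro γ ⟨hγ, hγ0, hγm⟩
    have hmap : (γ.comap Subtype.val).map (Subtype.val : unitInterval → ℝ) = γ := by
      rw [map_comap_subtype_coe hI, Measure.restrict_eq_self_of_ae_mem]
      exact hγ0
    have hprob : IsProbabilityMeasure (γ.comap (Subtype.val : unitInterval → ℝ)) := by
      have : IsProbabilityMeasure ((γ.comap Subtype.val).map (Subtype.val : unitInterval → ℝ)) := by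
        rwa [hmap]
      exact Measure.isProbabilityMeasure_of_map Subtype.val
    rw [← hmap]
    congr 1
    refine unitInterval_measure_ext_of_moments _ _ fun k => ?_
    have h := hγm ((Finset.range k).map E)
    rw [← lintegral_subtype_comap hI, Finset.card_map, Finset.card_range, hm',
      Finset.card_map, Finset.card_range, ← hmom k] at h
    have h' := h.trans (lintegral_ofReal_pow_unitInterval (γ.comap Subtype.val) k)
    have hnn : ∀ ρ : Measure unitInterval, 0 ≤ ∫ x : unitInterval, (x : ℝ) ^ k ∂ρ := fun ρ =>
      integral_nonneg fun x => pow_nonneg x.2.1 k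
    exact ((ENNReal.ofReal_eq_ofReal_iff (hnn _) (hnn _)).mp h').symm
  have hsupp : μ.map Subtype.val (Set.Icc (0:ℝ) 1)ᶜ = 0 := by
    rw [Measure.map_apply measurable_subtype_coe hI.compl]
    simp
  refine ⟨μ.map Subtype.val, ⟨Measure.isProbabilityMeasure_map
    measurable_subtype_coe.aemeasurable, hsupp, fun A => ?_⟩, huniq⟩
  rw [Measure.restrict_eq_self_of_ae_mem (show ∀ᵐ x ∂(μ.map Subtype.val), x ∈ Set.Icc (0:ℝ) 1
    from hsupp), lintegral_map (by fun_prop) measurable_subtype_coe,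
    lintegral_ofReal_pow_unitInterval, hmom, hm']
end
end
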